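/- There exists a function s : ℕ → ℚ that is computable (in Mathlib's sense), strictly monotone increasing, satisfies 0 < s n and s n < 1 for all n, and such that the real number ⨆ n, (s n : ℝ) is not a computable real. -/

import Mathlib

/-- A real number is computable if some computable sequence of rationals
approximates it with error at most `(1/2)^n`. -/
def IsComputableReal (x : ℝ) : Prop :=
  ∃ f : ℕ → ℚ, Computable f ∧ ∀ n : ℕ, |x - (f n : ℝ)| ≤ (1 / 2 : ℝ) ^ n

section

open Encodable

/-- `Denumerable.ofEncodableOfInfinite` enumerates the codes of the given encoding in increasing
order. -/
theorem Denumerable.encode_ofNat_ofEncodableOfInfinite (α : Type*) [Encodable α] [Infinite α]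
    (n : ℕ) :
    encode (@Denumerable.ofNat α (ofEncodableOfInfinite α) n) =
      Nat.nth (· ∈ Set.range (encode : α → ℕ)) n := by
  let := decidableRangeEncode α
  have : Infinite (Set.range (encode : α → ℕ)) :=
    Infinite.of_injective _ (Equiv.ofInjective _ encode_injective).injective
  let e : ℕ → ℕ := fun n => Nat.Subtype.ofNat (Set.range (encode : α → ℕ)) n
  have he : StrictMono e := strictMono_nat_of_lt_succ fun n => Nat.Subtype.lt_succ_self _
  have hr : Set.range e = Set.range (encode : α → ℕ) := Nat.Subtype.coe_comp_ofNat_range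
  have h₁ : encode (@Denumerable.ofNat α (ofEncodableOfInfinite α) n) = e n := by
    rw [ofEncodableOfInfinite, Denumerable.ofEquiv_ofNat]
    change encode ((equivRangeEncode α).symm _) = _
    have key : ∀ x : Set.range (encode : α → ℕ),
        encode ((equivRangeEncode α).symm x) = x := fun x =>
      congrArg Subtype.val ((equivRangeEncode α).apply_symm_apply x)
    rw [key, Nat.Subtype.denumerable, Denumerable.ofEquiv_ofNat]
    rfl
  have h₂ := Nat.nth_comp_of_strictMono (p := (· ∈ Set.range e)) (n := n) he
    (fun k hk => hk) (fun hf => absurd hf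
      (Set.infinite_range_of_injective he.injective))
  rw [h₁, ← hr, ← h₂]
  simp

theorem Int.natAbs_eq_encode (z : ℤ) : z.natAbs = (encode z + 1) / 2 := by
  cases z with
  | ofNat n =>
    have : encode (Int.ofNat n) = 2 * n := rfl
    rw [this]; simp; omega
  | negSucc n =>
    have : encode (Int.negSucc n) = 2 * n + 1 := rfl
    rw [this]; simp; omega

theorem Int.nonneg_iff_encode_even (z : ℤ) : 0 ≤ z ↔ encode z % 2 = 0 := by
  cases z with
  | ofNat n =>
    have : encode (Int.ofNat n) = 2 * n := rfl
    rw [this]; simp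
  | negSucc n =>
    have : encode (Int.negSucc n) = 2 * n + 1 := rfl
    rw [this]; simp

theorem Rat.encode_eq_pair (q : ℚ) :
    Rat.instEncodable.encode q = Nat.pair (encode q.num) q.den :=
  rfl

theorem PrimrecPred.count {p : ℕ → Prop} [DecidablePred p] (hp : PrimrecPred p) :
    Primrec (Nat.count p) := by
  have : Primrec fun n =>
      Nat.rec (motive := fun _ => ℕ) 0 (fun k c => c + if p k then 1 else 0) n :=
    Primrec.nat_rec₁ 0 <| Primrec.nat_add.comp .snd <|
      Primrec.ite (hp.comp .fst) (.const 1) (.const 0)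
  refine this.of_eq fun n => ?_
  induction n with
  | zero => simp
  | succ n ih => simp [Nat.count_succ, ← ih]

/-- A computable total relation with values in `ℕ` has a computable choice function. -/
theorem ComputablePred.exists_computable_choice {α : Type*} [Primcodable α] {p : α → ℕ → Prop}
    (hp : ComputablePred fun x : α × ℕ => p x.1 x.2) (h : ∀ a, ∃ n, p a n) :
    ∃ g : α → ℕ, Computable g ∧ ∀ a, p a (g a) := by
  obtain ⟨hd, hp⟩ := hp
  have (a : α) (n : ℕ) : Decidable (p a n) := hd (a, n)
  have hr : Partrec fun a => Nat.rfind fun n => Part.some (decide (p a n)) :=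
    Partrec.rfind <| Computable.partrec <| hp.of_eq fun _ => by congr
  have hs (a : α) : ∃ n, n ∈ Nat.rfind fun n => Part.some (decide (p a n)) :=
    have ⟨_, hm⟩ := h a
    have ⟨n, hn, _⟩ := Nat.rfind_min' (p := fun n => decide (p a n)) (decide_eq_true hm)
    ⟨n, hn⟩
  choose g hg using hs
  exact ⟨g, hr.of_eq_tot hg, fun a =>
    of_decide_eq_true (Part.mem_some_iff.1 (Nat.rfind_spec (hg a))).symm⟩

/-- A function with a computable graph is computable. -/
theorem Computable.of_graph {α β : Type*} [Primcodable α] [Denumerable β] {f : α → β}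
    (h : ComputablePred fun p : α × β => f p.1 = p.2) : Computable f := by
  obtain ⟨_, h⟩ := h
  obtain ⟨g, hg, hfg⟩ := ComputablePred.exists_computable_choice
    (p := fun a n => f a = Denumerable.ofNat β n)
    ⟨fun _ => _, h.comp (Computable.fst.pair ((Computable.ofNat β).comp Computable.snd))⟩
    fun a => ⟨encode (f a), (Denumerable.ofNat_encode _).symm⟩
  exact ((Computable.ofNat β).comp hg).of_eq fun a => (hfg a).symm

theorem PrimrecPred.computable_nth {p : ℕ → Prop} (hp : PrimrecPred p)
    (hi : (Set.ofPred p).Infinite) :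
    Computable (Nat.nth p) := by
  classical
  apply Computable.of_graph
  have : PrimrecPred fun x : ℕ × ℕ => p x.2 ∧ Nat.count p x.2 = x.1 :=
    (hp.comp Primrec.snd).and (Primrec.eq.comp ((hp.count).comp .snd) .fst)
  refine ComputablePred.of_eq ⟨_, Primrec.to_comp this.decide⟩ fun x => ?_
  constructor
  · rintro ⟨h₁, h₂⟩
    rw [← h₂, Nat.nth_count h₁]
  · intro h
    rw [← h]
    exact ⟨Nat.nth_mem_of_infinite hi _, Nat.count_nth_of_infinite hi _⟩

theorem Primrec.coprime : PrimrecRel Nat.Coprime := by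
  have hd : PrimrecRel fun a b : ℕ => b % a = 0 :=
    Primrec.eq.comp (Primrec.nat_mod.comp .snd .fst) (.const 0)
  have h : PrimrecRel fun (c : ℕ) (x : ℕ × ℕ) => ¬ (x.1 % c = 0 ∧ x.2 % c = 0) ∨ c = 1 :=
    PrimrecPred.or
      (PrimrecPred.not <| PrimrecPred.and (hd.comp .fst (.comp .fst .snd))
        (hd.comp .fst (.comp .snd .snd)))
      (Primrec.eq.comp .fst (.const 1))
  have := h.forall_mem_list.comp (f := fun x : ℕ × ℕ => List.range (x.1 + x.2 + 2))
    (Primrec.list_range.comp <| Primrec.succ.comp <| Primrec.succ.comp <|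
      Primrec.nat_add.comp .fst .snd) .id
  refine PrimrecPred.of_eq this fun x => ?_
  simp only [List.mem_range, ← Nat.dvd_iff_mod_eq_zero, id]
  constructor
  · intro H
    refine (H (x.1.gcd x.2) ?_).resolve_left
      (not_not_intro ⟨Nat.gcd_dvd_left _ _, Nat.gcd_dvd_right _ _⟩)
    rcases Nat.eq_zero_or_pos x.1 with h0 | h0
    · simp [h0]
    · have := Nat.gcd_le_left x.2 h0
      omega
  · rintro H c -
    by_cases hc : c ∣ x.1 ∧ c ∣ x.2
    · exact .inr (Nat.eq_one_of_dvd_coprimes H hc.1 hc.2)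
    · exact .inl hc

theorem Rat.mem_range_encode_iff (m : ℕ) :
    m ∈ Set.range Rat.instEncodable.encode ↔
      0 < m.unpair.2 ∧ ((m.unpair.1 + 1) / 2).Coprime m.unpair.2 := by
  constructor
  · rintro ⟨q, rfl⟩
    rw [Rat.encode_eq_pair, Nat.unpair_pair]
    exact ⟨q.den_pos, by simpa [← Int.natAbs_eq_encode] using q.reduced⟩
  · rintro ⟨hd, hc⟩
    have hz : encode (Denumerable.ofNat ℤ m.unpair.1) = m.unpair.1 := Denumerable.encode_ofNat _
    refine ⟨⟨Denumerable.ofNat ℤ m.unpair.1, m.unpair.2, hd.ne', ?_⟩, ?_⟩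
    · rwa [Int.natAbs_eq_encode, hz]
    · exact (congrArg (Nat.pair · _) hz).trans m.pair_unpair

theorem Rat.computable_encode : Computable Rat.instEncodable.encode := by
  have hp : PrimrecPred (· ∈ Set.range Rat.instEncodable.encode) := by
    have h₁ : Primrec fun m : ℕ => m.unpair.1 := Primrec.fst.comp .unpair
    have h₂ : Primrec fun m : ℕ => m.unpair.2 := Primrec.snd.comp .unpair
    exact ((Primrec.nat_lt.comp (.const 0) h₂).and (Primrec.coprime.comp
      (Primrec.nat_div.comp (Primrec.succ.comp h₁) (.const 2)) h₂)).of_eq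
        fun m => (Rat.mem_range_encode_iff m).symm
  have hi : (Set.range Rat.instEncodable.encode).Infinite :=
    Set.infinite_range_of_injective (@encode_injective _ Rat.instEncodable)
  refine ((hp.computable_nth hi).comp Computable.encode).of_eq fun q => ?_
  refine (Denumerable.encode_ofNat_ofEncodableOfInfinite ℚ _).symm.trans ?_
  exact congrArg _ (Denumerable.ofNat_encode q)

theorem Rat.computable_encode_num : Computable fun q : ℚ => encode q.num :=
  (Computable.fst.comp (Computable.unpair.comp Rat.computable_encode)).of_eq fun q => by
    rw [Rat.encode_eq_pair, Nat.unpair_pair]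

theorem Rat.computable_den : Computable Rat.den :=
  (Computable.snd.comp (Computable.unpair.comp Rat.computable_encode)).of_eq fun q => by
    rw [Rat.encode_eq_pair, Nat.unpair_pair]

theorem Rat.computable_natAbs_num : Computable fun q : ℚ => q.num.natAbs :=
  ((Primrec.nat_div.to_comp).comp (Computable.succ.comp Rat.computable_encode_num)
    (.const 2)).of_eq fun _ => (Int.natAbs_eq_encode _).symm

theorem Rat.natAbs_num_eq_abs_mul_den (q : ℚ) : (q.num.natAbs : ℚ) = |q| * q.den := by
  rw [Nat.cast_natAbs, Int.cast_abs, ← Rat.mul_den_eq_num, abs_mul, Nat.abs_cast]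

theorem Computable.rat_div {α : Type*} [Primcodable α] {a b : α → ℕ} (ha : Computable a)
    (hb : Computable b) (h0 : ∀ x, b x ≠ 0) : Computable fun x => (a x / b x : ℚ) := by
  apply Computable.of_graph
  have h : Computable fun p : α × ℚ => decide (encode p.2.num % 2 = 0) &&
      decide (a p.1 * p.2.den = p.2.num.natAbs * b p.1) :=
    Primrec.and.to_comp.comp
      ((Primrec.eq.decide.to_comp).comp ((Primrec.nat_mod.to_comp).comp
        (Rat.computable_encode_num.comp .snd) (.const 2)) (.const 0))
      ((Primrec.eq.decide.to_comp).comp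
        ((Primrec.nat_mul.to_comp).comp (ha.comp .fst) (Rat.computable_den.comp .snd))
        ((Primrec.nat_mul.to_comp).comp (Rat.computable_natAbs_num.comp .snd) (hb.comp .fst)))
  refine ComputablePred.computable_iff.2 ⟨_, h, funext fun ⟨x, q⟩ => propext ?_⟩
  simp only [Bool.and_eq_true, decide_eq_true_eq, ← Int.nonneg_iff_encode_even]
  have hb0 : (b x : ℚ) ≠ 0 := by exact_mod_cast h0 x
  have hq0 : (q.den : ℚ) ≠ 0 := by exact_mod_cast q.den_ne_zero
  rw [Rat.num_nonneg, ← @Nat.cast_inj ℚ]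
  push_cast [Rat.natAbs_num_eq_abs_mul_den]
  constructor
  · intro h
    have : 0 ≤ q := h ▸ by positivity
    refine ⟨this, ?_⟩
    rw [abs_of_nonneg this, ← h]
    field_simp
  · rintro ⟨h, h'⟩
    rw [abs_of_nonneg h] at h'
    rw [div_eq_iff hb0]
    exact mul_right_cancel₀ hq0 (by linarith)
theorem ComputablePred.rat_abs_lt_div {α : Type*} [Primcodable α] {f : α → ℚ} {a b : α → ℕ}
    (hf : Computable f) (ha : Computable a) (hb : Computable b) (h0 : ∀ x, b x ≠ 0) :
    ComputablePred fun x => |f x| < (a x / b x : ℚ) := by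
  have h : Computable fun x => decide ((f x).num.natAbs * b x < a x * (f x).den) :=
    (Primrec.nat_lt.decide.to_comp).comp
      ((Primrec.nat_mul.to_comp).comp (Rat.computable_natAbs_num.comp hf) hb)
      ((Primrec.nat_mul.to_comp).comp ha (Rat.computable_den.comp hf))
  refine ComputablePred.computable_iff.2 ⟨_, h, funext fun x => propext ?_⟩
  have hb0 : (0 : ℚ) < b x := by exact_mod_cast Nat.pos_of_ne_zero (h0 x)
  have hq0 : (0 : ℚ) < (f x).den := by exact_mod_cast (f x).den_pos
  rw [decide_eq_true_eq, ← @Nat.cast_lt ℚ, lt_div_iff₀ hb0]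
  push_cast [Rat.natAbs_num_eq_abs_mul_den]
  rw [mul_right_comm, mul_lt_mul_iff_left₀ hq0]

theorem Primrec.const_pow (m : ℕ) : Primrec fun n : ℕ => m ^ n := by
  refine (Primrec.nat_rec₁ 1 (f := fun _ c => c * m)
    (Primrec.nat_mul.comp .snd (.const m))).of_eq fun n => ?_
  induction n with
  | zero => rfl
  | succ n ih => rw [pow_succ, ← ih]

namespace Specker

open Nat.Partrec (Code)

/-- The program with code `i` halts on input `0` within `n` steps. -/
def HaltsBy (n i : ℕ) : Prop :=
  ((Denumerable.ofNat Code i).evaln n 0).isSome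

instance (n i : ℕ) : Decidable (HaltsBy n i) :=
  inferInstanceAs (Decidable (_ = true))

theorem HaltsBy.mono {m n i : ℕ} (hmn : m ≤ n) (h : HaltsBy m i) : HaltsBy n i := by
  obtain ⟨x, hx⟩ := Option.isSome_iff_exists.1 h
  exact Option.isSome_iff_exists.2 ⟨x, Code.evaln_mono hmn hx⟩

theorem exists_haltsBy_iff (c : Code) : (∃ n, HaltsBy n (encode c)) ↔ (c.eval 0).Dom := by
  simp only [HaltsBy, Denumerable.ofNat_encode, Option.isSome_iff_exists, Part.dom_iff_mem]
  exact ⟨fun ⟨n, x, h⟩ => ⟨x, Code.evaln_sound h⟩,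
    fun ⟨x, h⟩ => have ⟨n, hn⟩ := Code.evaln_complete.1 h; ⟨n, x, hn⟩⟩

theorem primrecRel_haltsBy : PrimrecRel HaltsBy := by
  have h : Primrec fun p : ℕ × ℕ => ((Denumerable.ofNat Code p.2).evaln p.1 0).isSome :=
    Primrec.option_isSome.comp <| Code.primrec_evaln.comp <|
      (Primrec.fst.pair ((Primrec.ofNat Code).comp .snd)).pair (.const 0)
  exact Primrec.eq.comp h (.const true)

/-- The `i`-th base `4` digit of the `n`-th approximation. -/
def digit (n i : ℕ) : ℕ :=
  if HaltsBy n i then 2 else 1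

theorem one_le_digit (n i : ℕ) : 1 ≤ digit n i := by
  unfold digit; split_ifs <;> simp

theorem digit_le_two (n i : ℕ) : digit n i ≤ 2 := by
  unfold digit; split_ifs <;> simp

theorem digit_mono {m n : ℕ} (hmn : m ≤ n) (i : ℕ) : digit m i ≤ digit n i := by
  unfold digit
  split_ifs with h₁ h₂
  exacts [le_rfl, absurd (h₁.mono hmn) h₂, one_le_two, le_rfl]

/-- The `n`-th approximation: a base `4` expansion recording which of the programs with code at
most `n` halt within `n` steps. -/
def approx (n : ℕ) : ℚ :=
  ∑ i ∈ Finset.range (n + 1), (digit n i : ℚ) / 4 ^ (i + 1)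

/-- The integer whose base `4` digits are `digit n 0, …, digit n (k - 1)`. -/
def numerator (n k : ℕ) : ℕ :=
  k.rec 0 fun i c => 4 * c + digit n i

theorem sum_digit_eq (n k : ℕ) :
    ∑ i ∈ Finset.range k, (digit n i : ℚ) / 4 ^ (i + 1) = numerator n k / (4 ^ k : ℕ) := by
  induction k with
  | zero => simp [numerator]
  | succ k ih =>
    have : numerator n (k + 1) = 4 * numerator n k + digit n k := rfl
    rw [Finset.sum_range_succ, ih, this]
    push_cast
    field_simp
    ring

theorem approx_eq (n : ℕ) : approx n = numerator n (n + 1) / (4 ^ (n + 1) : ℕ) :=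
  sum_digit_eq n (n + 1)

theorem primrec_numerator : Primrec fun n => numerator n (n + 1) := by
  have hd : Primrec₂ digit := Primrec.ite primrecRel_haltsBy (.const 2) (.const 1)
  have hs : Primrec₂ fun (n : ℕ) (p : ℕ × ℕ) => 4 * p.2 + digit n p.1 := Primrec.nat_add.comp
    (Primrec.nat_mul.comp (.const 4) (Primrec.snd.comp .snd))
    (hd.comp .fst (Primrec.fst.comp .snd))
  exact Primrec.nat_rec' .succ (.const 0) hs

theorem primrec_four_pow_succ : Primrec fun n => 4 ^ (n + 1) :=
  (Primrec.const_pow 4).comp .succ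

theorem computable_approx : Computable approx :=
  (Computable.rat_div primrec_numerator.to_comp primrec_four_pow_succ.to_comp
    fun _ => by positivity).of_eq fun n => (approx_eq n).symm

theorem strictMono_approx : StrictMono approx := by
  refine strictMono_nat_of_lt_succ fun n => ?_
  rw [approx, approx, Finset.sum_range_succ _ (n + 1)]
  refine lt_add_of_le_of_pos (Finset.sum_le_sum fun i _ => ?_) ?_
  · gcongr
    exact digit_mono n.le_succ i
  · have := one_le_digit (n + 1) (n + 1)
    positivity

theorem approx_pos (n : ℕ) : 0 < approx n := by
  refine Finset.sum_pos (fun i _ => ?_) (by simp)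
  have := one_le_digit n i
  positivity

theorem approx_lt_one (n : ℕ) : approx n < 1 := by
  have key : ∀ k, numerator n k < 4 ^ k := by
    intro k
    induction k with
    | zero => simp [numerator]
    | succ k ih =>
      have h : numerator n (k + 1) = 4 * numerator n k + digit n k := rfl
      have := digit_le_two n k
      rw [h, pow_succ]
      omega
  rw [approx_eq, div_lt_one (by positivity)]
  exact_mod_cast key (n + 1)

/-- If a program halts only after step `n`, the `n`-th approximation is far from later ones. -/
theorem approx_add_le {m n i : ℕ} (hn : ¬ HaltsBy n i) (hm : HaltsBy m i) (hi : i ≤ m) :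
    approx n + 1 / 4 ^ (i + 1) ≤ approx m := by
  have hnm : n ≤ m := le_of_not_ge fun h => hn (hm.mono h)
  let d : ℕ → ℚ := fun j => if j < n + 1 then (digit n j : ℚ) else 0
  have hd : approx n = ∑ j ∈ Finset.range (m + 1), d j / 4 ^ (j + 1) := by
    rw [approx, ← Finset.sum_subset (Finset.range_mono (Nat.succ_le_succ hnm))]
    · exact Finset.sum_congr rfl fun j hj => by
        dsimp only [d]
        rw [if_pos (Finset.mem_range.1 hj)]
    · intro j _ hj
      dsimp only [d]
      rw [if_neg (Finset.mem_range.not.1 hj), zero_div]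
  have hdj : ∀ j, d j ≤ digit m j := fun j => by
    dsimp only [d]
    split_ifs
    · exact_mod_cast digit_mono hnm j
    · positivity
  have hdi : d i + 1 ≤ digit m i := by
    have : d i ≤ 1 := by dsimp only [d]; split_ifs <;> simp [digit, hn]
    simp only [digit, if_pos hm]
    push_cast
    linarith
  have := Finset.single_le_sum (s := Finset.range (m + 1))
    (f := fun j => (digit m j - d j) / 4 ^ (j + 1))
    (fun j _ => div_nonneg (sub_nonneg.2 (hdj j)) (by positivity))
    (Finset.mem_range.2 (Nat.lt_succ_of_le hi))
  simp only [sub_div, Finset.sum_sub_distrib, ← hd] at this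
  have h1 : (d i + 1) / 4 ^ (i + 1) ≤ digit m i / 4 ^ (i + 1) := by gcongr
  rw [add_div] at h1
  rw [approx.eq_1 m]
  linarith

theorem bddAbove_range_approx : BddAbove (Set.range fun n => (approx n : ℝ)) :=
  ⟨1, Set.forall_mem_range.2 fun n => by exact_mod_cast (approx_lt_one n).le⟩

theorem not_isComputableReal_iSup_approx : ¬ IsComputableReal (⨆ n, (approx n : ℝ)) := by
  rintro ⟨f, hf, hfx⟩
  set x := ⨆ n, (approx n : ℝ) with hx
  have hle : ∀ n, (approx n : ℝ) ≤ x := le_ciSup bddAbove_range_approx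
  have hx0 : 0 ≤ x := le_trans (by exact_mod_cast (approx_pos 0).le) (hle 0)
  have hfx' : ∀ k, abs (x - |(f k : ℝ)|) ≤ (1 / 2 : ℝ) ^ k := fun k => by
    simpa only [abs_of_nonneg hx0] using (abs_abs_sub_abs_le x (f k)).trans (hfx k)
  let k : Code → ℕ := fun c => 2 * encode c + 4
  have hk : Computable k := Primrec.to_comp <|
    Primrec.nat_add.comp (Primrec.nat_mul.comp (.const 2) .encode) (.const 4)
  have hpow : Computable fun p : Code × ℕ => 2 ^ k p.1 :=
    (Primrec.const_pow 2).to_comp.comp (hk.comp .fst)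
  have hfour : Computable fun p : Code × ℕ => 4 ^ (p.2 + 1) :=
    primrec_four_pow_succ.to_comp.comp .snd
  have hP : ComputablePred fun p : Code × ℕ => |f (k p.1)| < approx p.2 + 2 / 2 ^ k p.1 := by
    refine (ComputablePred.rat_abs_lt_div (hf.comp (hk.comp .fst))
      ((Primrec.nat_add.to_comp).comp
        ((Primrec.nat_mul.to_comp).comp (primrec_numerator.to_comp.comp .snd) hpow)
        ((Primrec.nat_mul.to_comp).comp (.const 2) hfour))
      ((Primrec.nat_mul.to_comp).comp hfour hpow) fun _ => by positivity).of_eq fun p => ?_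
    rw [approx_eq]
    push_cast
    rw [div_add_div _ _ (by positivity) (by positivity), mul_comm (2 : ℚ) (4 ^ _)]
  obtain ⟨g, hg, hgP⟩ := ComputablePred.exists_computable_choice
    (p := fun c n => |f (k c)| < approx n + 2 / 2 ^ k c) hP fun c => by
      have h := (abs_le.1 (hfx' (k c))).1
      have hpos : (0 : ℝ) < 1 / 2 ^ k c := by positivity
      have : |(f (k c) : ℝ)| - 2 / 2 ^ k c < x := by
        rw [div_pow, one_pow] at h
        linarith [mul_one_div (2 : ℝ) (2 ^ k c)]
      obtain ⟨n, hn⟩ := exists_lt_of_lt_ciSup this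
      refine ⟨n, ?_⟩
      rw [← Rat.cast_lt (K := ℝ)]
      push_cast
      linarith
  have hH : ComputablePred fun c : Code => HaltsBy (g c) (encode c) :=
    ⟨inferInstance, primrecRel_haltsBy.decide.to_comp.comp hg .encode⟩
  refine ComputablePred.halting_problem 0 (hH.of_eq fun c => ?_)
  rw [← exists_haltsBy_iff]
  refine ⟨fun h => ⟨_, h⟩, fun ⟨m, hm⟩ => by_contra fun hn => ?_⟩
  have h₁ : approx (g c) + 1 / 4 ^ (encode c + 1) ≤ approx (max m (encode c)) :=
    approx_add_le hn (hm.mono (le_max_left _ _)) (le_max_right _ _)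
  have h₂ := hgP c
  rw [← Rat.cast_le (K := ℝ)] at h₁
  rw [← Rat.cast_lt (K := ℝ)] at h₂
  push_cast at h₁ h₂
  have h₃ := (abs_le.1 (hfx' (k c))).2
  have h₄ := hle (max m (encode c))
  have hk2 : (2 : ℝ) ^ k c = 4 ^ (encode c + 1) * 4 := by
    rw [← pow_succ, show k c = 2 * (encode c + 1 + 1) by ring, pow_mul]
    norm_num
  have hpos : (0 : ℝ) < 1 / 4 ^ (encode c + 1) := by positivity
  rw [div_pow, one_pow, hk2, ← div_div] at h₃
  rw [hk2, ← div_div, ← mul_one_div 2] at h₂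
  linarith

end Specker

end

theorem specker_sequence_exists :
    ∃ s : ℕ → ℚ, Computable s ∧ StrictMono s ∧ (∀ n, 0 < s n ∧ s n < 1) ∧
      ¬ IsComputableReal (⨆ n, (s n : ℝ)) := by
  exact ⟨Specker.approx, Specker.computable_approx, Specker.strictMono_approx,
    fun n => ⟨Specker.approx_pos n, Specker.approx_lt_one n⟩,
    Specker.not_isComputableReal_iSup_approx⟩
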